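/- For all j ≥ 1 and all n ≥ 1, the number of 231-avoiding permutations σ of {1,…,n} with des(σ) = j and md(σ) = j (maximum drop exactly j) equals the binomial coefficient C(n+j−1, 2j). -/

import Mathlib

/-- σ avoids the pattern 231: no indices i < j < k with σ k < σ i < σ j. -/
def avoids231 {n : ℕ} (σ : Equiv.Perm (Fin n)) : Prop :=
  ¬ ∃ i j k : Fin n, i < j ∧ j < k ∧ σ k < σ i ∧ σ i < σ j

/-- The number of descents of σ : positions i with σ i > σ (i+1). -/
noncomputable def des {n : ℕ} (σ : Equiv.Perm (Fin n)) : ℕ :=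
  Nat.card {i : Fin n // ∃ h : (i : ℕ) + 1 < n, σ ⟨(i : ℕ) + 1, h⟩ < σ i}

/-- The maximum drop of σ : the maximum of i - σ i. -/
def maxDrop {n : ℕ} (σ : Equiv.Perm (Fin n)) : ℕ :=
  Finset.univ.sup fun i : Fin n => (i : ℕ) - (σ i : ℕ)

/-- a n j k : the number of 231-avoiding permutations of {1,…,n} with
j descents and maximum drop at most k. -/
noncomputable def a (n j k : ℕ) : ℕ :=
  Nat.card {σ : Equiv.Perm (Fin n) // avoids231 σ ∧ des σ = j ∧ maxDrop σ ≤ k}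

open Finset

/-- The permutation sending `p` to `v` and order-isomorphic to `τ` on the other positions. -/
def insertAt {n : ℕ} (p v : Fin (n + 1)) (τ : Equiv.Perm (Fin n)) : Equiv.Perm (Fin (n + 1)) :=
  ((finSuccEquiv' p).trans τ.optionCongr).trans (finSuccEquiv' v).symm

variable {n : ℕ}

@[simp] lemma insertAt_self (p v : Fin (n + 1)) (τ : Equiv.Perm (Fin n)) :
    insertAt p v τ p = v := by simp [insertAt]

@[simp] lemma insertAt_succAbove (p v : Fin (n + 1)) (τ : Equiv.Perm (Fin n)) (i : Fin n) :
    insertAt p v τ (p.succAbove i) = v.succAbove (τ i) := by simp [insertAt]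

lemma insertAt_injective (p v : Fin (n + 1)) : Function.Injective (insertAt p v) := by
  intro τ τ' h
  ext i
  have := congrArg (fun σ : Equiv.Perm _ => σ (p.succAbove i)) h
  simp only [insertAt_succAbove, Fin.succAbove_right_inj] at this
  rw [this]

lemma exists_insertAt_eq {p v : Fin (n + 1)} {σ : Equiv.Perm (Fin (n + 1))} (h : σ p = v) :
    ∃ τ, insertAt p v τ = σ := by
  have key : ∀ e : Equiv.Perm (Option (Fin n)), e none = none → e.removeNone.optionCongr = e := by
    intro e he
    ext1 x
    cases x with
    | none => simp [he]
    | some x =>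
      have : e (some x) ≠ none := fun h => by simpa using e.injective (h.trans he.symm)
      obtain ⟨y, hy⟩ := Option.ne_none_iff_exists'.1 this
      exact Equiv.removeNone_some e ⟨y, hy⟩
  refine ⟨(((finSuccEquiv' p).symm.trans σ).trans (finSuccEquiv' v)).removeNone, ?_⟩
  rw [insertAt, key _ (by simp [h])]
  ext; simp

lemma des_eq_sum (σ : Equiv.Perm (Fin n)) :
    des σ = ∑ i : Fin n, if ∃ h : (i : ℕ) + 1 < n, σ ⟨(i : ℕ) + 1, h⟩ < σ i then 1 else 0 := by
  classical
  rw [des, Nat.card_eq_fintype_card, Fintype.card_subtype, Finset.card_filter]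

lemma avoids231_of_insertAt {p v : Fin (n + 1)} {τ : Equiv.Perm (Fin n)}
    (h : avoids231 (insertAt p v τ)) : avoids231 τ := by
  rintro ⟨i, j, k, hij, hjk, h₁, h₂⟩
  exact h ⟨p.succAbove i, p.succAbove j, p.succAbove k, by simpa, by simpa, by simpa, by simpa⟩

lemma avoids231_insertAt_of_forall {p v : Fin (n + 1)} {τ : Equiv.Perm (Fin n)}
    (hτ : avoids231 τ)
    (h : p = 0 ∧ v = 0 ∨ p = Fin.last n ∧ v = Fin.last n ∨ p = 0 ∧ v = Fin.last n) :
    avoids231 (insertAt p v τ) := by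
  rintro ⟨i, j, k, hij, hjk, h₁, h₂⟩
  obtain rfl | ⟨i, rfl⟩ := Fin.eq_self_or_eq_succAbove p i
  · rcases h with ⟨rfl, rfl⟩ | ⟨rfl, rfl⟩ | ⟨rfl, rfl⟩
    · simp at h₁
    · exact absurd hij (Fin.le_last _).not_gt
    · simp at h₂; exact absurd h₂ (Fin.le_last _).not_gt
  obtain rfl | ⟨j, rfl⟩ := Fin.eq_self_or_eq_succAbove p j
  · rcases h with ⟨rfl, rfl⟩ | ⟨rfl, rfl⟩ | ⟨rfl, rfl⟩
    · simp at hij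
    · exact absurd hjk (Fin.le_last _).not_gt
    · simp at hij
  obtain rfl | ⟨k, rfl⟩ := Fin.eq_self_or_eq_succAbove p k
  · rcases h with ⟨rfl, rfl⟩ | ⟨rfl, rfl⟩ | ⟨rfl, rfl⟩
    · simp at hjk
    · rw [insertAt_self] at h₁; exact absurd h₁ (Fin.le_last _).not_gt
    · simp at hjk
  simp only [insertAt_succAbove, Fin.succAbove_lt_succAbove_iff] at *
  exact hτ ⟨i, j, k, hij, hjk, h₁, h₂⟩

lemma insertAt_zero_succ (v : Fin (n + 1)) (τ : Equiv.Perm (Fin n)) (i : Fin n) :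
    insertAt 0 v τ i.succ = v.succAbove (τ i) := by
  simpa using insertAt_succAbove 0 v τ i

lemma insertAt_last_castSucc (v : Fin (n + 1)) (τ : Equiv.Perm (Fin n)) (i : Fin n) :
    insertAt (Fin.last n) v τ i.castSucc = v.succAbove (τ i) := by
  simpa using insertAt_succAbove (Fin.last n) v τ i

lemma des_insertAt_zero (v : Fin (n + 1)) (τ : Equiv.Perm (Fin n)) :
    des (insertAt 0 v τ) =
      (if ∃ h : 0 < n, v.succAbove (τ ⟨0, h⟩) < v then 1 else 0) + des τ := by
  rw [des_eq_sum, des_eq_sum, Fin.sum_univ_succ]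
  congr 1
  · congr 1
    simp only [insertAt_self, eq_iff_iff]
    constructor <;> rintro ⟨h, h'⟩
    · have h : 0 < n := by simpa using h
      exact ⟨h, by rw [← insertAt_zero_succ]; exact h'⟩
    · exact ⟨by simpa using h, by rw [← insertAt_zero_succ] at h'; exact h'⟩
  · refine Finset.sum_congr rfl fun i _ => ?_
    congr 1
    rw [eq_iff_iff]
    constructor <;> rintro ⟨h, h'⟩
    · have h : (i : ℕ) + 1 < n := by simpa using h
      refine ⟨h, ?_⟩
      rw [← Fin.succAbove_lt_succAbove_iff (p := v), ← insertAt_zero_succ, ← insertAt_zero_succ]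
      exact h'
    · refine ⟨by simpa using h, ?_⟩
      rw [← Fin.succAbove_lt_succAbove_iff (p := v), ← insertAt_zero_succ,
        ← insertAt_zero_succ] at h'
      exact h'

lemma des_insertAt_zero_zero (τ : Equiv.Perm (Fin n)) : des (insertAt 0 0 τ) = des τ := by
  simp [des_insertAt_zero]

lemma des_insertAt_zero_last (hn : 0 < n) (τ : Equiv.Perm (Fin n)) :
    des (insertAt 0 (Fin.last n) τ) = des τ + 1 := by
  rw [des_insertAt_zero, if_pos ⟨hn, by simp [Fin.castSucc_lt_last]⟩, add_comm]

lemma des_insertAt_last_last (τ : Equiv.Perm (Fin n)) :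
    des (insertAt (Fin.last n) (Fin.last n) τ) = des τ := by
  rw [des_eq_sum, des_eq_sum, Fin.sum_univ_castSucc, if_neg (by simp), add_zero]
  refine Finset.sum_congr rfl fun i _ => ?_
  congr 1
  rw [eq_iff_iff, insertAt_last_castSucc]
  constructor
  · rintro ⟨h, h'⟩
    by_cases hi : (i : ℕ) + 1 < n
    · refine ⟨hi, ?_⟩
      rw [← Fin.succAbove_lt_succAbove_iff (p := Fin.last n), ← insertAt_last_castSucc]
      exact h'
    · have : (⟨(i.castSucc : ℕ) + 1, h⟩ : Fin (n + 1)) = Fin.last n := by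
        ext; simp; lia
      rw [this, insertAt_self] at h'
      exact absurd h' (Fin.le_last _).not_gt
  · rintro ⟨h, h'⟩
    refine ⟨by simp, ?_⟩
    rw [← Fin.succAbove_lt_succAbove_iff (p := Fin.last n), ← insertAt_last_castSucc] at h'
    exact h'

lemma maxDrop_le_iff (σ : Equiv.Perm (Fin n)) (k : ℕ) :
    maxDrop σ ≤ k ↔ ∀ i : Fin n, (i : ℕ) ≤ σ i + k := by
  simp [maxDrop, add_comm]

lemma maxDrop_insertAt_zero_zero (τ : Equiv.Perm (Fin n)) :
    maxDrop (insertAt 0 0 τ) = maxDrop τ := by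
  refine eq_of_forall_ge_iff fun k => ?_
  simp only [maxDrop_le_iff, Fin.forall_fin_succ, insertAt_zero_succ]
  simp
  refine forall_congr' fun i => by lia

lemma maxDrop_insertAt_last_last (τ : Equiv.Perm (Fin n)) :
    maxDrop (insertAt (Fin.last n) (Fin.last n) τ) = maxDrop τ := by
  refine eq_of_forall_ge_iff fun k => ?_
  simp only [maxDrop_le_iff, Fin.forall_fin_succ', insertAt_last_castSucc]
  simp

lemma maxDrop_insertAt_zero_last (hn : 0 < n) (τ : Equiv.Perm (Fin n)) :
    maxDrop (insertAt 0 (Fin.last n) τ) = maxDrop τ + 1 := by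
  refine eq_of_forall_ge_iff fun k => ?_
  obtain _ | k := k
  · have : ¬ maxDrop (insertAt 0 (Fin.last n) τ) ≤ 0 := by
      rw [maxDrop_le_iff]
      intro h
      have := h (Fin.last n)
      obtain ⟨m, rfl⟩ : ∃ m, n = m + 1 := ⟨n - 1, by lia⟩
      rw [← Fin.succ_last, insertAt_zero_succ] at this
      simp at this
      lia
    simp [this]
  · rw [Nat.add_le_add_iff_right]
    simp only [maxDrop_le_iff, Fin.forall_fin_succ, insertAt_zero_succ]
    simp
    refine forall_congr' fun i => by lia

/-- `σ` has a descent at position `i`. -/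
def IsDescent (σ : Equiv.Perm (Fin n)) (i : Fin n) : Prop :=
  ∃ h : (i : ℕ) + 1 < n, σ ⟨(i : ℕ) + 1, h⟩ < σ i

lemma exists_isDescent (σ : Equiv.Perm (Fin n)) {p q : Fin n} (hpq : p ≤ q) (h : σ q < σ p) :
    ∃ s, p ≤ s ∧ s < q ∧ IsDescent σ s := by
  by_contra! hc
  have key : ∀ m (hm : m < n), (p : ℕ) ≤ m → m ≤ q → σ p ≤ σ ⟨m, hm⟩ := by
    intro m hm hpm
    induction m, hpm using Nat.le_induction with
    | base => intro _; exact le_rfl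
    | succ m hpm ih =>
      intro hmq
      refine (ih (by lia) (by lia)).trans ?_
      by_contra! hlt
      exact hc ⟨m, by lia⟩ hpm (Fin.lt_def.2 (show m < (q : ℕ) by lia)) ⟨hm, hlt⟩
  exact (key q q.2 hpq le_rfl).not_gt h

lemma sub_le_card_filter (σ : Equiv.Perm (Fin n)) (i : Fin n) :
    (i : ℕ) - σ i ≤ #{q : Fin n | q < i ∧ σ i < σ q} := by
  have h1 : #{q : Fin n | q < i} = i := by
    rw [← Fin.card_Iio i]
    congr 1
    ext q
    simp
  have h2 : #{q : Fin n | q < i ∧ ¬ σ i < σ q} ≤ σ i := by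
    rw [← Fin.card_Iio (σ i), ← Finset.card_map σ.toEmbedding]
    refine Finset.card_le_card fun x hx => ?_
    simp only [mem_map, mem_filter, mem_univ, true_and, mem_Iio] at hx ⊢
    obtain ⟨q, ⟨hq, hq'⟩, rfl⟩ := hx
    exact lt_of_le_of_ne (not_lt.1 hq') (σ.injective.ne hq.ne)
  have h3 := Finset.card_filter_add_card_filter_not
    (s := ({q : Fin n | q < i} : Finset (Fin n))) (fun q => σ i < σ q)
  rw [Finset.filter_filter, Finset.filter_filter] at h3
  lia

open Classical in
lemma card_filter_le_card_isDescent {σ : Equiv.Perm (Fin n)} (hσ : avoids231 σ) (i : Fin n) :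
    #{q : Fin n | q < i ∧ σ i < σ q} ≤
      #{s : Fin n | IsDescent σ s ∧ s < i ∧ ∃ q ≤ s, σ i < σ q} := by
  have hex : ∀ q : Fin n, q < i ∧ σ i < σ q → ∃ s, q ≤ s ∧ IsDescent σ s ∧
      ∀ t, q ≤ t → IsDescent σ t → s ≤ t := by
    intro q hq
    obtain ⟨s, h1, -, h2⟩ := exists_isDescent σ hq.1.le hq.2
    obtain ⟨m, hm, hmin⟩ := WellFounded.has_min (wellFounded_lt (α := Fin n))
      {s | q ≤ s ∧ IsDescent σ s} ⟨s, h1, h2⟩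
    exact ⟨m, hm.1, hm.2, fun t h1 h2 => not_lt.1 (hmin t ⟨h1, h2⟩)⟩
  choose! f hf1 hf2 hf3 using hex
  have hlt : ∀ q q', q < i ∧ σ i < σ q → q < q' → σ q' < σ q → f q < q' := by
    intro q q' hq h h'
    obtain ⟨s, h1, h2, h3⟩ := exists_isDescent σ h.le h'
    exact (hf3 q hq s h1 h3).trans_lt h2
  have hne : ∀ q q', q < i ∧ σ i < σ q → q' < i ∧ σ i < σ q' → q < q' → f q < f q' := by
    intro q q' hq hq' h
    refine (hlt q q' hq h ?_).trans_le (hf1 q' hq')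
    by_contra! hle
    exact hσ ⟨q, q', i, h, hq'.1, hq.2, lt_of_le_of_ne hle (σ.injective.ne h.ne)⟩
  refine Finset.card_le_card_of_injOn f ?_ ?_
  · intro q hq
    simp only [coe_filter, mem_univ, true_and, Set.mem_ofPred_eq] at hq ⊢
    exact ⟨hf2 q hq, hlt q i hq hq.1 hq.2, q, hf1 q hq, hq.2⟩
  · intro q hq q' hq' h
    simp only [coe_filter, mem_univ, true_and, Set.mem_ofPred_eq] at hq hq'
    rcases lt_trichotomy q q' with h' | h' | h'
    · exact absurd h (hne q q' hq hq' h').ne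
    · exact h'
    · exact absurd h (hne q' q hq' hq h').ne'

lemma exists_maxDrop_position {σ : Equiv.Perm (Fin n)} (h : avoids231 σ) (hd : des σ = maxDrop σ)
    (hpos : 0 < des σ) :
    ∃ i : Fin n, σ i < i ∧ ∀ s, IsDescent σ s → s < i ∧ ∃ q ≤ s, σ i < σ q := by
  classical
  have hne : (Finset.univ : Finset (Fin n)).Nonempty := by
    by_contra! hc
    rw [hd, maxDrop, hc] at hpos
    simp at hpos
  obtain ⟨i, -, hi⟩ := Finset.exists_mem_eq_sup _ hne fun i : Fin n => (i : ℕ) - (σ i : ℕ)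
  have hdes : des σ = #{s : Fin n | IsDescent σ s} := by
    rw [des, ← Fintype.card_subtype, ← Nat.card_eq_fintype_card]
    rfl
  have h1 := (sub_le_card_filter σ i).trans (card_filter_le_card_isDescent h i)
  change maxDrop σ = _ at hi
  refine ⟨i, Fin.lt_def.2 (by lia), fun s hs => ?_⟩
  have heq := Finset.eq_of_subset_of_card_le
    (s := ({s : Fin n | IsDescent σ s ∧ s < i ∧ ∃ q ≤ s, σ i < σ q} : Finset (Fin n)))
    (t := ({s : Fin n | IsDescent σ s} : Finset (Fin n)))
    (fun s hs => by simp at hs ⊢; exact hs.1) (by lia)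
  have : s ∈ ({s : Fin n | IsDescent σ s} : Finset (Fin n)) := by simpa using hs
  rw [← heq] at this
  simp at this
  simpa using this.2

lemma apply_zero_or_last {σ : Equiv.Perm (Fin (n + 1))} (h : avoids231 σ)
    (hd : des σ = maxDrop σ) (hpos : 0 < des σ) :
    σ 0 = 0 ∨ σ (Fin.last n) = Fin.last n ∨ σ 0 = Fin.last n := by
  obtain ⟨i, hi, hdesc⟩ := exists_maxDrop_position h hd hpos
  have hi0 : 0 < i := (Fin.zero_le _).trans_lt hi
  rcases lt_or_gt_of_ne (σ.injective.ne hi0.ne) with h0 | h0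
  · left
    by_contra hne
    obtain ⟨z, hz⟩ := σ.surjective 0
    have hzlt : σ z < σ 0 := by rw [hz]; exact Fin.pos_iff_ne_zero.2 hne
    obtain ⟨s, -, hsz, hs⟩ := exists_isDescent σ (Fin.zero_le z) hzlt
    obtain ⟨-, q, hqs, hq⟩ := hdesc s hs
    refine h ⟨0, q, z, Fin.pos_iff_ne_zero.2 ?_, hqs.trans_lt hsz, hzlt, h0.trans hq⟩
    rintro rfl
    exact h0.not_gt hq
  · right
    by_contra! hne
    obtain ⟨z, hz⟩ := σ.surjective (Fin.last n)
    have hz0 : z ≠ 0 := by rintro rfl; exact hne.2 hz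
    have hzl : z ≠ Fin.last n := by rintro rfl; exact hne.1 hz
    rcases lt_or_ge z i with hzi | hzi
    · exact h ⟨0, z, i, Fin.pos_iff_ne_zero.2 hz0, hzi, h0, by
        rw [hz]; exact Fin.lt_last_iff_ne_last.2 hne.2⟩
    · obtain ⟨s, hzs, -, hs⟩ := exists_isDescent σ (Fin.le_last z)
        (by rw [hz]; exact Fin.lt_last_iff_ne_last.2 hne.1)
      exact (hzi.trans hzs).not_gt (hdesc s hs).1

/-- `σ` avoids 231 and has exactly `j` descents and maximum drop `j`. -/
def IsExtremal (j : ℕ) (σ : Equiv.Perm (Fin n)) : Prop :=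
  avoids231 σ ∧ des σ = j ∧ maxDrop σ = j

lemma avoids231_insertAt {p v : Fin (n + 1)} {τ : Equiv.Perm (Fin n)}
    (h : p = 0 ∧ v = 0 ∨ p = Fin.last n ∧ v = Fin.last n ∨ p = 0 ∧ v = Fin.last n) :
    avoids231 (insertAt p v τ) ↔ avoids231 τ :=
  ⟨avoids231_of_insertAt, fun hτ => avoids231_insertAt_of_forall hτ h⟩

lemma isExtremal_insertAt_zero_zero {j : ℕ} {τ : Equiv.Perm (Fin n)} :
    IsExtremal j (insertAt 0 0 τ) ↔ IsExtremal j τ := by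
  simp [IsExtremal, avoids231_insertAt, des_insertAt_zero_zero, maxDrop_insertAt_zero_zero]

lemma isExtremal_insertAt_last_last {j : ℕ} {τ : Equiv.Perm (Fin n)} :
    IsExtremal j (insertAt (Fin.last n) (Fin.last n) τ) ↔ IsExtremal j τ := by
  simp [IsExtremal, avoids231_insertAt, des_insertAt_last_last, maxDrop_insertAt_last_last]

lemma isExtremal_insertAt_zero_last (hn : 0 < n) {j : ℕ} {τ : Equiv.Perm (Fin n)} :
    IsExtremal (j + 1) (insertAt 0 (Fin.last n) τ) ↔ IsExtremal j τ := by
  simp [IsExtremal, avoids231_insertAt, des_insertAt_zero_last hn, maxDrop_insertAt_zero_last hn]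

lemma card_apply_eq_and (p v : Fin (n + 1)) (P : Equiv.Perm (Fin (n + 1)) → Prop) :
    Nat.card {σ // σ p = v ∧ P σ} = Nat.card {τ // P (insertAt p v τ)} := by
  refine (Nat.card_congr (Equiv.ofBijective
    (fun τ : {τ // P (insertAt p v τ)} => ⟨insertAt p v τ, insertAt_self p v τ, τ.2⟩)
    ⟨fun τ τ' h => ?_, ?_⟩)).symm
  · exact Subtype.ext (insertAt_injective p v (congrArg Subtype.val h))
  · rintro ⟨σ, hσ, hP⟩
    obtain ⟨τ, rfl⟩ := exists_insertAt_eq hσ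
    exact ⟨⟨τ, hP⟩, rfl⟩

lemma card_subtype_and_add_card_subtype_not_and {α : Type*} [Finite α] (Q P : α → Prop) :
    Nat.card {x // Q x ∧ P x} + Nat.card {x // ¬ Q x ∧ P x} = Nat.card {x // P x} := by
  classical
  have := Fintype.ofFinite α
  simp only [Nat.card_eq_fintype_card, Fintype.card_subtype, and_comm (b := P _)]
  rw [← Finset.filter_filter, ← Finset.filter_filter, Finset.card_filter_add_card_filter_not]

lemma card_isExtremal_succ (n j : ℕ) :
    Nat.card {σ : Equiv.Perm (Fin (n + 1)) // IsExtremal j σ} =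
      Nat.card {σ : Equiv.Perm (Fin n) // IsExtremal j σ} +
        Nat.card {σ : Equiv.Perm (Fin (n + 1)) // σ 0 ≠ 0 ∧ IsExtremal j σ} := by
  rw [← card_subtype_and_add_card_subtype_not_and (fun σ => σ 0 = 0), card_apply_eq_and]
  simp only [isExtremal_insertAt_zero_zero, ne_eq]

lemma card_apply_zero_ne_isExtremal_succ (n j : ℕ) :
    Nat.card {σ : Equiv.Perm (Fin (n + 2)) // σ 0 ≠ 0 ∧ IsExtremal (j + 1) σ} =
      Nat.card {σ : Equiv.Perm (Fin (n + 1)) // σ 0 ≠ 0 ∧ IsExtremal (j + 1) σ} +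
        Nat.card {σ : Equiv.Perm (Fin (n + 1)) // IsExtremal j σ} := by
  rw [← card_subtype_and_add_card_subtype_not_and
    (fun σ : Equiv.Perm (Fin (n + 2)) => σ (Fin.last _) = Fin.last _), card_apply_eq_and]
  congr 1
  · refine Nat.card_congr (Equiv.subtypeEquivRight fun τ => ?_)
    rw [isExtremal_insertAt_last_last, ← Fin.castSucc_zero, insertAt_last_castSucc]
    simp
  · have h : ∀ σ : Equiv.Perm (Fin (n + 2)),
        (¬ σ (Fin.last _) = Fin.last _ ∧ σ 0 ≠ 0 ∧ IsExtremal (j + 1) σ) ↔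
          (σ 0 = Fin.last _ ∧ IsExtremal (j + 1) σ) := by
      intro σ
      constructor
      · rintro ⟨h1, h2, h⟩
        have := apply_zero_or_last h.1 (h.2.1.trans h.2.2.symm) (by rw [h.2.1]; lia)
        tauto
      · rintro ⟨h0, h⟩
        refine ⟨fun h1 => ?_, by simp [h0], h⟩
        simpa using σ.injective (h0.trans h1.symm)
    simp only [h, card_apply_eq_and, isExtremal_insertAt_zero_last n.succ_pos]

lemma isExtremal_zero_iff {σ : Equiv.Perm (Fin n)} : IsExtremal 0 σ ↔ σ = 1 := by
  constructor
  · rintro ⟨-, h, -⟩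
    have hmono : StrictMono σ := by
      intro p q hpq
      by_contra! hle
      obtain ⟨s, -, -, hs⟩ :=
        exists_isDescent σ hpq.le (lt_of_le_of_ne hle (σ.injective.ne hpq.ne'))
      rcases Finite.card_eq_zero_iff.1 h with ⟨hempty⟩
      exact hempty ⟨s, hs⟩
    exact Equiv.coe_fn_injective ((hmono.range_inj strictMono_id).1 (by simp))
  · rintro rfl
    refine ⟨?_, ?_, ?_⟩
    · rintro ⟨i, j, k, hij, hjk, h, -⟩
      exact (hij.trans hjk).not_gt h
    · refine Finite.card_eq_zero_iff.2 ⟨?_⟩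
      rintro ⟨i, hi, h⟩
      simp [Fin.lt_def] at h
    · simp [maxDrop]

lemma card_isExtremal_zero (n : ℕ) :
    Nat.card {σ : Equiv.Perm (Fin n) // IsExtremal 0 σ} = 1 := by
  simp [isExtremal_zero_iff]

lemma card_isExtremal (n j : ℕ) :
    Nat.card {σ : Equiv.Perm (Fin (n + 1)) // IsExtremal j σ} = (n + j).choose (2 * j) ∧
      Nat.card {σ : Equiv.Perm (Fin (n + 1)) // σ 0 ≠ 0 ∧ IsExtremal (j + 1) σ} =
        (n + j).choose (2 * j + 1) := by
  induction n generalizing j with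
  | zero =>
    have h : ∀ j, Nat.card {σ : Equiv.Perm (Fin (0 + 1)) // σ 0 ≠ 0 ∧ IsExtremal j σ} = 0 :=
      fun j => Finite.card_eq_zero_iff.2 ⟨fun σ => σ.2.1 (Subsingleton.elim (α := Fin 1) _ _)⟩
    refine ⟨?_, by rw [h, Nat.choose_eq_zero_of_lt (by lia)]⟩
    obtain _ | j := j
    · simp [card_isExtremal_zero]
    · rw [card_isExtremal_succ, h, Nat.choose_eq_zero_of_lt (by lia), add_zero]
      refine Finite.card_eq_zero_iff.2 ⟨fun σ => ?_⟩
      have := σ.2.2.2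
      simp [maxDrop] at this
  | succ n ih =>
    have hH : ∀ j, Nat.card {σ : Equiv.Perm (Fin (n + 2)) // σ 0 ≠ 0 ∧ IsExtremal (j + 1) σ} =
        (n + 1 + j).choose (2 * j + 1) := by
      intro j
      rw [card_apply_zero_ne_isExtremal_succ, (ih j).1, (ih j).2,
        show n + 1 + j = n + j + 1 by ring, Nat.choose_succ_succ', add_comm]
    refine ⟨?_, hH j⟩
    obtain _ | j := j
    · simp [card_isExtremal_zero]
    · rw [card_isExtremal_succ, hH, (ih (j + 1)).1, show n + 1 + (j + 1) = n + (j + 1) + 1 by ring,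
        show 2 * (j + 1) = 2 * j + 1 + 1 by ring, Nat.choose_succ_succ', add_comm,
        show n + 1 + j = n + (j + 1) by ring]

theorem card_maxDrop_eq_des (n j : ℕ) (hj : 1 ≤ j) (hn : 1 ≤ n) :
    Nat.card {σ : Equiv.Perm (Fin n) // avoids231 σ ∧ des σ = j ∧ maxDrop σ = j} =
      (n + j - 1).choose (2 * j) := by
  obtain ⟨n, rfl⟩ : ∃ m, n = m + 1 := ⟨n - 1, by lia⟩
  rw [show n + 1 + j - 1 = n + j by lia]
  exact (card_isExtremal n j).1
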